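/- If the kernel satisfies 0 ≤ k(x,y) ≤ K for all x, y, then for i.i.d. samples of size m from each of p and q (all 2m samples mutually independent), the KID estimator satisfies the concentration bound P[|KID − MMD²(p,q)| > ε] ≤ 2 exp(−ε² m / (16 K²)) for all ε > 0. -/

import Mathlib

open MeasureTheory

/-- sub-Gaussian bound for the centered function -/
def KidSG {X : Type*} [MeasurableSpace X] (μ : Measure X) (f : X → ℝ) (A : ℝ) : Prop :=
  ∀ t : ℝ, ∫ x, Real.exp (t * (f x - ∫ y, f y ∂μ)) ∂μ ≤ Real.exp (A * t ^ 2 / 2)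

lemma kid_int_bdd {X : Type*} [MeasurableSpace X] (μ : Measure X) [IsProbabilityMeasure μ]
    (f : X → ℝ) (hf : Measurable f) (C : ℝ) (hC : ∀ x, |f x| ≤ C) : Integrable f μ :=
  Integrable.of_bound hf.aestronglyMeasurable C (ae_of_all _ hC)

lemma kid_abs_integral {X : Type*} [MeasurableSpace X] (μ : Measure X) [IsProbabilityMeasure μ]
    (f : X → ℝ) (C : ℝ) (hC : ∀ x, |f x| ≤ C) : |∫ x, f x ∂μ| ≤ C := by
  have := norm_integral_le_of_norm_le_const (μ := μ) (f := f) (C := C) (ae_of_all _ hC)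
  simpa using this

lemma kid_exp_int {X : Type*} [MeasurableSpace X] (μ : Measure X) [IsProbabilityMeasure μ]
    (f : X → ℝ) (hf : Measurable f) (C : ℝ) (hC : ∀ x, |f x| ≤ C) (t a : ℝ) :
    Integrable (fun x => Real.exp (t * (f x - a))) μ := by
  refine kid_int_bdd μ _ (by fun_prop) (Real.exp (|t| * (C + |a|))) fun x => ?_
  rw [Real.abs_exp, Real.exp_le_exp]
  refine (le_abs_self _).trans ?_
  rw [abs_mul]
  gcongr
  exact (abs_sub _ _).trans (by gcongr; exact hC x)

lemma kid_prod {X Y : Type*} [MeasurableSpace X] [MeasurableSpace Y]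
    (μ : Measure X) (ν : Measure Y) [IsProbabilityMeasure μ] [IsProbabilityMeasure ν]
    (F : X × Y → ℝ) (hF : Measurable F) (C : ℝ) (hC : ∀ z, |F z| ≤ C) (A B : ℝ)
    (h1 : ∀ x, KidSG ν (fun y => F (x, y)) A)
    (h2 : KidSG μ (fun x => ∫ y, F (x, y) ∂ν) B) : KidSG (μ.prod ν) F (A + B) := by
  intro t
  have hg : Measurable (fun x => ∫ y, F (x, y) ∂ν) :=
    (hF.stronglyMeasurable.integral_prod_right').measurable
  have hgC : ∀ x, |∫ y, F (x, y) ∂ν| ≤ C := fun x => kid_abs_integral ν _ C fun y => hC _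
  have hE := integral_prod F (kid_int_bdd (μ.prod ν) F hF C hC)
  have h2t := h2 t
  rw [← hE] at h2t
  set E := ∫ z, F z ∂(μ.prod ν) with hEdef
  have hi := kid_exp_int (μ.prod ν) F hF C hC t E
  rw [integral_prod _ hi]
  have hb : ∀ x, ∫ y, Real.exp (t * (F (x, y) - E)) ∂ν ≤
      Real.exp (A * t ^ 2 / 2) * Real.exp (t * ((∫ y, F (x, y) ∂ν) - E)) := by
    intro x
    have : ∀ y, Real.exp (t * (F (x, y) - E)) =
        Real.exp (t * (F (x, y) - ∫ y, F (x, y) ∂ν)) *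
          Real.exp (t * ((∫ y, F (x, y) ∂ν) - E)) := by
      intro y
      rw [← Real.exp_add]; ring_nf
    simp_rw [this]
    rw [integral_mul_const]
    gcongr
    exact h1 x t
  calc _ ≤ ∫ x, Real.exp (A * t ^ 2 / 2) * Real.exp (t * ((∫ y, F (x, y) ∂ν) - E)) ∂μ :=
        integral_mono hi.integral_prod_left ((kid_exp_int μ _ hg C hgC t E).const_mul _) hb
    _ = Real.exp (A * t ^ 2 / 2) * ∫ x, Real.exp (t * ((∫ y, F (x, y) ∂ν) - E)) ∂μ :=
        integral_const_mul _ _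
    _ ≤ Real.exp (A * t ^ 2 / 2) * Real.exp (B * t ^ 2 / 2) := by gcongr
    _ = _ := by rw [← Real.exp_add]; ring_nf

lemma kid_hoeffding {X : Type*} [MeasurableSpace X] (μ : Measure X) [IsProbabilityMeasure μ]
    (f : X → ℝ) (hf : Measurable f) (C : ℝ) (hC : ∀ x, |f x| ≤ C) (c : ℝ)
    (hc : ∀ x y, |f x - f y| ≤ c) : KidSG μ f (c ^ 2 / 4) := by
  have hne : Nonempty X := nonempty_of_isProbabilityMeasure μ
  have hbd : BddBelow (Set.range f) := ⟨-C, by rintro _ ⟨x, rfl⟩; exact (abs_le.1 (hC x)).1⟩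
  have hm : ∀ᵐ x ∂μ, f x ∈ Set.Icc (⨅ x, f x) ((⨅ x, f x) + c) := by
    refine ae_of_all _ fun x => ⟨ciInf_le hbd x, ?_⟩
    have : f x - c ≤ ⨅ x, f x := le_ciInf fun y => by linarith [(abs_le.1 (hc x y)).2]
    linarith
  have h := ProbabilityTheory.hasSubgaussianMGF_of_mem_Icc hf.aemeasurable hm
  intro t
  have h2 := h.mgf_le t
  simp only [ProbabilityTheory.mgf] at h2
  refine h2.trans (le_of_eq ?_)
  congr 3
  simp [div_pow]
  norm_num

lemma kid_mcdiarmid {S : Type*} [MeasurableSpace S] (p : Measure S) [IsProbabilityMeasure p]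
    (c : ℝ) : ∀ (n : ℕ) (f : (Fin n → S) → ℝ), Measurable f → ∀ C : ℝ, (∀ x, |f x| ≤ C) →
    (∀ x i s, |f (Function.update x i s) - f x| ≤ c) →
    KidSG (Measure.pi fun _ : Fin n => p) f (n * (c ^ 2 / 4)) := by
  intro n
  induction n with
  | zero =>
    intro f hf C hC hd t
    have : ∀ x, f x = f default := fun x => by rw [Subsingleton.elim x default]
    simp [this]
  | succ n ih =>
    intro f hf C hC hd
    set e := MeasurableEquiv.piFinSuccAbove (fun _ : Fin (n+1) => S) 0 with he
    have hmp : MeasurePreserving e (Measure.pi fun _ : Fin (n+1) => p)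
      (p.prod (Measure.pi fun _ : Fin n => p)) :=
      measurePreserving_piFinSuccAbove (fun _ : Fin (n+1) => p) 0
    have hes : ∀ s y, e.symm (s, y) = (Fin.cons s y : Fin (n+1) → S) := by
      intro s y
      simp [he, MeasurableEquiv.piFinSuccAbove, Fin.insertNthEquiv]
    have hF : Measurable (fun z => f (e.symm z)) := hf.comp e.symm.measurable
    have hFs : ∀ s, Measurable (fun y => f (e.symm (s, y))) := fun s =>
      hF.comp measurable_prodMk_left
    have key : KidSG (p.prod (Measure.pi fun _ : Fin n => p)) (fun z => f (e.symm z))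
        (n * (c ^ 2 / 4) + c ^ 2 / 4) := by
      refine kid_prod _ _ _ hF C (fun z => hC _) _ _ ?_ ?_
      · intro s
        refine ih _ (hFs s) C (fun _ => hC _) ?_
        intro y i v
        have := hd (Fin.cons s y) i.succ v
        rw [← Fin.cons_update] at this
        rwa [hes, hes]
      · refine kid_hoeffding p _ (hF.stronglyMeasurable.integral_prod_right').measurable C
          (fun s => kid_abs_integral _ _ C fun y => hC _) c ?_
        intro s s'
        rw [← integral_sub (kid_int_bdd _ _ (hFs s) C fun _ => hC _)
          (kid_int_bdd _ _ (hFs s') C fun _ => hC _)]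
        refine kid_abs_integral _ _ c fun y => ?_
        have := hd (Fin.cons s' y) 0 s
        rw [Fin.update_cons_zero] at this
        rwa [hes, hes]
    intro t
    have k2 := key t
    have i1 : ∫ z, f (e.symm z) ∂(p.prod (Measure.pi fun _ : Fin n => p)) =
        ∫ x, f x ∂(Measure.pi fun _ : Fin (n+1) => p) := by
      rw [← hmp.integral_comp e.measurableEmbedding]; simp
    rw [i1, ← hmp.integral_comp e.measurableEmbedding] at k2
    simp only [MeasurableEquiv.symm_apply_apply] at k2
    refine k2.trans (le_of_eq ?_)
    push_cast
    ring_nf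

lemma kid_tail {X : Type*} [MeasurableSpace X] (μ : Measure X) [IsProbabilityMeasure μ]
    (f : X → ℝ) (hf : Measurable f) (C : ℝ) (hC : ∀ x, |f x| ≤ C) (A : ℝ) (hA : 0 ≤ A)
    (h : KidSG μ f A) (ε : ℝ) (hε : 0 < ε) :
    μ {x | ε < |f x - ∫ y, f y ∂μ|} ≤ ENNReal.ofReal (2 * Real.exp (-ε ^ 2 / (2 * A))) := by
  have hs : ProbabilityTheory.HasSubgaussianMGF (fun x => f x - ∫ y, f y ∂μ) ⟨A, hA⟩ μ :=
    ⟨fun t => kid_exp_int μ f hf C hC t _, h⟩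
  have h1 := hs.measure_ge_le hε.le
  have h2 := hs.neg.measure_ge_le hε.le
  have hsub : {x | ε < |f x - ∫ y, f y ∂μ|} ⊆ {x | ε ≤ f x - ∫ y, f y ∂μ} ∪
      {x | ε ≤ (-fun x => f x - ∫ y, f y ∂μ) x} := by
    intro x hx
    have hx' : ε < |f x - ∫ y, f y ∂μ| := hx
    rcases lt_abs.1 hx' with h | h
    · exact Or.inl h.le
    · exact Or.inr h.le
  have : μ.real {x | ε < |f x - ∫ y, f y ∂μ|} ≤ 2 * Real.exp (-ε ^ 2 / (2 * A)) := by
    refine (measureReal_mono hsub).trans ((measureReal_union_le _ _).trans ?_)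
    rw [two_mul]
    exact add_le_add h1 h2
  rw [← ofReal_measureReal]
  exact ENNReal.ofReal_le_ofReal this

lemma kid_pair {S : Type*} [MeasurableSpace S] (p : Measure S) [IsProbabilityMeasure p]
    (m : ℕ) (i j : Fin m) (hij : i ≠ j) :
    MeasurePreserving (fun x : Fin m → S => (x i, x j)) (Measure.pi fun _ : Fin m => p)
      (p.prod p) := by
  refine ⟨by fun_prop, ?_⟩
  have h := ProbabilityTheory.iIndepFun_pi (μ := fun _ : Fin m => p) (X := fun _ (s : S) => s)
    (fun _ => aemeasurable_id)
  have h2 := (h.indepFun hij)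
  rw [ProbabilityTheory.indepFun_iff_map_prod_eq_prod_map_map
    (measurable_pi_apply i).aemeasurable (measurable_pi_apply j).aemeasurable] at h2
  rw [h2]
  congr 1
  · exact (measurePreserving_eval (fun _ : Fin m => p) i).map_eq
  · exact (measurePreserving_eval (fun _ : Fin m => p) j).map_eq

lemma kid_offdiag (m : ℕ) (I : ℝ) :
    ∑ i : Fin m, ∑ j : Fin m, (if i ≠ j then I else 0) = (m : ℝ) * (m - 1) * I := by
  have : ∀ i j : Fin m, (if i ≠ j then I else 0) = I - if i = j then I else 0 := by
    intro i j; split_ifs <;> simp_all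
  simp only [this, Finset.sum_sub_distrib]
  simp
  ring

lemma kid_Ubd {S : Type*} (k : S → S → ℝ) (K : ℝ) (hK : 0 < K)
    (hk : ∀ x y, 0 ≤ k x y ∧ k x y ≤ K) (m : ℕ) (x : Fin m → S) (a : Fin m) (s : S) :
    |∑ i, ∑ j, (if i ≠ j then k (Function.update x a s i) (Function.update x a s j) else 0) -
      ∑ i, ∑ j, (if i ≠ j then k (x i) (x j) else 0)| ≤ 2 * ((m : ℝ) - 1) * K := by
  have hT : ∑ i : Fin m, ∑ j : Fin m, (if i ≠ j then
      ((if i = a then K else 0) + (if j = a then K else 0)) else 0) = 2 * ((m : ℝ) - 1) * K := by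
    have : ∀ i j : Fin m, (if i ≠ j then
      ((if i = a then K else 0) + (if j = a then K else 0)) else 0) =
      (if i = a then K else 0) + (if j = a then K else 0) -
        (if i = j then (if j = a then 2 * K else 0) else 0) := by
      intro i j; split_ifs <;> simp_all <;> ring
    simp only [this, Finset.sum_sub_distrib, Finset.sum_add_distrib]
    simp
    ring
  rw [← hT]
  simp only [← Finset.sum_sub_distrib]
  refine (Finset.abs_sum_le_sum_abs _ _).trans (Finset.sum_le_sum fun i _ => ?_)
  refine (Finset.abs_sum_le_sum_abs _ _).trans (Finset.sum_le_sum fun j _ => ?_)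
  have hd : ∀ u v u' v', |k u v - k u' v'| ≤ K := fun u v u' v' => by
    rw [abs_le]; constructor <;> linarith [hk u v, hk u' v']
  by_cases hij : i = j
  · simp [hij]
  simp only [ne_eq, hij, not_false_eq_true, if_true]
  by_cases hi : i = a <;> by_cases hj : j = a
  · exact absurd (hi.trans hj.symm) hij
  · simpa [hi, hj] using hd _ _ _ _
  · simpa [hi, hj] using hd _ _ _ _
  · simp [hi, hj]

lemma kid_Cbd {S : Type*} (k : S → S → ℝ) (K : ℝ)
    (hk : ∀ x y, 0 ≤ k x y ∧ k x y ≤ K) (m : ℕ) (x y : Fin m → S) (a : Fin m) (s : S) :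
    |∑ i, ∑ j, k (Function.update x a s i) (y j) - ∑ i, ∑ j, k (x i) (y j)| ≤ m * K := by
  have hT : ∑ i : Fin m, ∑ j : Fin m, (if i = a then K else 0) = m * K := by
    simp [← Finset.mul_sum]
  rw [← hT]
  simp only [← Finset.sum_sub_distrib]
  refine (Finset.abs_sum_le_sum_abs _ _).trans (Finset.sum_le_sum fun i _ => ?_)
  refine (Finset.abs_sum_le_sum_abs _ _).trans (Finset.sum_le_sum fun j _ => ?_)
  by_cases hi : i = a
  · simp only [hi, if_true, Function.update_self]
    rw [abs_le]; constructor <;> linarith [hk s (y j), hk (x a) (y j)]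
  · simp [hi]

/-- the estimator -/
noncomputable def kidEst {S : Type*} (k : S → S → ℝ) (m : ℕ)
    (w : (Fin m → S) × (Fin m → S)) : ℝ :=
  ((m : ℝ) * ((m : ℝ) - 1))⁻¹ *
                ∑ i, ∑ j, (if i ≠ j then k (w.1 i) (w.1 j) else 0)
              - 2 / ((m : ℝ) * (m : ℝ)) * ∑ i, ∑ j, k (w.1 i) (w.2 j)
              + ((m : ℝ) * ((m : ℝ) - 1))⁻¹ *
                ∑ i, ∑ j, (if i ≠ j then k (w.2 i) (w.2 j) else 0)

lemma kid_diff_arith (m K U C : ℝ) (hm : 2 ≤ m) (hU : |U| ≤ 2 * (m - 1) * K)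
    (hC : |C| ≤ m * K) : |(m * (m - 1))⁻¹ * U - 2 / (m * m) * C| ≤ 4 * K / m := by
  have h1 : 0 < m - 1 := by linarith
  have h0 : 0 < m := by linarith
  refine (abs_sub _ _).trans ?_
  rw [abs_mul, abs_mul, abs_of_pos (by positivity : 0 < (m * (m - 1))⁻¹),
    abs_of_pos (by positivity : 0 < 2 / (m * m))]
  calc _ ≤ (m * (m - 1))⁻¹ * (2 * (m - 1) * K) + 2 / (m * m) * (m * K) := by gcongr
    _ = _ := by field_simp; ring

lemma kid_d1 {S : Type*} (k : S → S → ℝ) (K : ℝ) (hK : 0 < K)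
    (hk : ∀ x y, 0 ≤ k x y ∧ k x y ≤ K) (m : ℕ) (hm : 2 ≤ m) (x y : Fin m → S) (a : Fin m)
    (s : S) : |kidEst k m (Function.update x a s, y) - kidEst k m (x, y)| ≤ 4 * K / m := by
  have := kid_diff_arith m K _ _ (by exact_mod_cast hm) (kid_Ubd k K hK hk m x a s)
    (kid_Cbd k K hk m x y a s)
  refine le_trans (le_of_eq ?_) this
  simp only [kidEst]
  ring_nf

lemma kid_symm {S : Type*} (k : S → S → ℝ) (hsym : ∀ x y, k x y = k y x) (m : ℕ)
    (x y : Fin m → S) : kidEst k m (x, y) = kidEst k m (y, x) := by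
  simp only [kidEst]
  have : ∑ i, ∑ j, k (x i) (y j) = ∑ i, ∑ j, k (y i) (x j) := by
    rw [Finset.sum_comm]
    simp only [hsym]
  rw [this]; ring

lemma kid_meas {S : Type*} [MeasurableSpace S] (k : S → S → ℝ)
    (hmeas : Measurable fun z : S × S => k z.1 z.2) (m : ℕ) : Measurable (kidEst k m) := by
  have hh : ∀ u v : (Fin m → S) × (Fin m → S) → S, Measurable u → Measurable v →
      Measurable fun w => k (u w) (v w) := fun u v hu hv => hmeas.comp (hu.prodMk hv)
  unfold kidEst
  refine ((Measurable.const_mul ?_ _).sub (Measurable.const_mul ?_ _)).add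
    (Measurable.const_mul ?_ _)
  all_goals
    refine Finset.measurable_sum _ fun i _ => Finset.measurable_sum _ fun j _ => ?_
  · split_ifs
    · exact hh _ _ (by fun_prop) (by fun_prop)
    · exact measurable_const
  · exact hh _ _ (by fun_prop) (by fun_prop)
  · split_ifs
    · exact hh _ _ (by fun_prop) (by fun_prop)
    · exact measurable_const

lemma kid_bdd {S : Type*} (k : S → S → ℝ) (K : ℝ) (hK : 0 < K)
    (hk : ∀ x y, 0 ≤ k x y ∧ k x y ≤ K) (m : ℕ) : ∃ C, ∀ w, |kidEst k m w| ≤ C := by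
  have hb : ∀ g : Fin m → Fin m → ℝ, (∀ i j, |g i j| ≤ K) →
      |∑ i, ∑ j, g i j| ≤ ∑ _i : Fin m, ∑ _j : Fin m, K := fun g hg =>
    (Finset.abs_sum_le_sum_abs _ _).trans (Finset.sum_le_sum fun i _ =>
      (Finset.abs_sum_le_sum_abs _ _).trans (Finset.sum_le_sum fun j _ => hg i j))
  have hkk : ∀ x y, |k x y| ≤ K := fun x y => abs_le.2 ⟨by linarith [hk x y], (hk x y).2⟩
  have hii : ∀ (z : Fin m → S) (i j : Fin m),
      |if i ≠ j then k (z i) (z j) else 0| ≤ K := by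
    intro z i j
    split_ifs
    · exact hkk _ _
    · simpa using hK.le
  refine ⟨|((m : ℝ) * ((m : ℝ) - 1))⁻¹| * (∑ _i : Fin m, ∑ _j : Fin m, K) +
    |2 / ((m : ℝ) * (m : ℝ))| * (∑ _i : Fin m, ∑ _j : Fin m, K) +
    |((m : ℝ) * ((m : ℝ) - 1))⁻¹| * (∑ _i : Fin m, ∑ _j : Fin m, K), fun w => ?_⟩
  unfold kidEst
  refine (abs_add_le _ _).trans (add_le_add ((abs_sub _ _).trans (add_le_add ?_ ?_)) ?_)
  · rw [abs_mul]
    exact mul_le_mul_of_nonneg_left (hb _ (hii w.1)) (abs_nonneg _)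
  · rw [abs_mul]
    exact mul_le_mul_of_nonneg_left (hb _ fun i j => hkk _ _) (abs_nonneg _)
  · rw [abs_mul]
    exact mul_le_mul_of_nonneg_left (hb _ (hii w.2)) (abs_nonneg _)

lemma kid_lin {X : Type*} [MeasurableSpace X] (μ : Measure X) (a b c : ℝ) {f g h : X → ℝ}
    (hf : Integrable f μ) (hg : Integrable g μ) (hh : Integrable h μ) :
    ∫ x, (a * f x - b * g x + c * h x) ∂μ = a * ∫ x, f x ∂μ - b * ∫ x, g x ∂μ + c * ∫ x, h x ∂μ := by
  have h1 : Integrable (fun x => a * f x - b * g x) μ := (hf.const_mul a).sub (hg.const_mul b)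
  rw [integral_add h1 (hh.const_mul c), integral_sub (hf.const_mul a) (hg.const_mul b),
    integral_const_mul, integral_const_mul, integral_const_mul]

lemma kid_mean {S : Type*} [MeasurableSpace S]
    (k : S → S → ℝ) (K : ℝ) (hK : 0 < K)
    (hk : ∀ x y, 0 ≤ k x y ∧ k x y ≤ K)
    (hmeas : Measurable fun z : S × S => k z.1 z.2)
    (p q : Measure S) [IsProbabilityMeasure p] [IsProbabilityMeasure q]
    (m : ℕ) (hm : 2 ≤ m) :
    ∫ w, kidEst k m w ∂((Measure.pi fun _ : Fin m => p).prod (Measure.pi fun _ : Fin m => q)) =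
      (∫ z : S × S, k z.1 z.2 ∂(p.prod p)) - 2 * (∫ z : S × S, k z.1 z.2 ∂(p.prod q))
                + ∫ z : S × S, k z.1 z.2 ∂(q.prod q) := by
  set P := (Measure.pi fun _ : Fin m => p) with hP
  set Q := (Measure.pi fun _ : Fin m => q) with hQ
  have hkk : ∀ x y, |k x y| ≤ K := fun x y => abs_le.2 ⟨by linarith [hk x y], (hk x y).2⟩
  have hint : ∀ u v : (Fin m → S) × (Fin m → S) → S, Measurable u → Measurable v →
      Integrable (fun w => k (u w) (v w)) (P.prod Q) := fun u v hu hv =>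
    kid_int_bdd _ _ (hmeas.comp (hu.prodMk hv)) K fun _ => hkk _ _
  have hmp : ∀ (ρ : Measure (S × S)) (u : (Fin m → S) × (Fin m → S) → S × S),
      MeasurePreserving u (P.prod Q) ρ →
      ∫ w, k (u w).1 (u w).2 ∂(P.prod Q) = ∫ z, k z.1 z.2 ∂ρ := by
    intro ρ u hu
    rw [← hu.map_eq, integral_map hu.measurable.aemeasurable hmeas.aestronglyMeasurable]
  have e1 : ∀ i j : Fin m, ∫ w : (Fin m → S) × (Fin m → S),
      (if i ≠ j then k (w.1 i) (w.1 j) else 0) ∂(P.prod Q) =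
      if i ≠ j then ∫ z : S × S, k z.1 z.2 ∂(p.prod p) else 0 := by
    intro i j
    split_ifs with h
    · exact hmp _ _ ((kid_pair p m i j h).comp measurePreserving_fst)
    · simp
  have e3 : ∀ i j : Fin m, ∫ w : (Fin m → S) × (Fin m → S),
      (if i ≠ j then k (w.2 i) (w.2 j) else 0) ∂(P.prod Q) =
      if i ≠ j then ∫ z : S × S, k z.1 z.2 ∂(q.prod q) else 0 := by
    intro i j
    split_ifs with h
    · exact hmp _ _ ((kid_pair q m i j h).comp measurePreserving_snd)
    · simp
  have e2 : ∀ i j : Fin m, ∫ w : (Fin m → S) × (Fin m → S), k (w.1 i) (w.2 j) ∂(P.prod Q) =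
      ∫ z : S × S, k z.1 z.2 ∂(p.prod q) := by
    intro i j
    exact hmp _ _ ((measurePreserving_eval (fun _ : Fin m => p) i).prod
      (measurePreserving_eval (fun _ : Fin m => q) j))
  have I1 : ∀ i j : Fin m, Integrable (fun w : (Fin m → S) × (Fin m → S) =>
      (if i ≠ j then k (w.1 i) (w.1 j) else 0)) (P.prod Q) := by
    intro i j
    split_ifs
    · exact hint _ _ (by fun_prop) (by fun_prop)
    · exact integrable_const _
  have I3 : ∀ i j : Fin m, Integrable (fun w : (Fin m → S) × (Fin m → S) =>
      (if i ≠ j then k (w.2 i) (w.2 j) else 0)) (P.prod Q) := by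
    intro i j
    split_ifs
    · exact hint _ _ (by fun_prop) (by fun_prop)
    · exact integrable_const _
  have I2 : ∀ i j : Fin m, Integrable (fun w : (Fin m → S) × (Fin m → S) =>
      k (w.1 i) (w.2 j)) (P.prod Q) := fun i j => hint _ _ (by fun_prop) (by fun_prop)
  have hsum : ∀ g : Fin m → Fin m → ((Fin m → S) × (Fin m → S)) → ℝ,
      (∀ i j, Integrable (g i j) (P.prod Q)) →
      Integrable (fun w => ∑ i, ∑ j, g i j w) (P.prod Q) ∧
      ∫ w, ∑ i, ∑ j, g i j w ∂(P.prod Q) = ∑ i, ∑ j, ∫ w, g i j w ∂(P.prod Q) := by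
    intro g hg
    refine ⟨integrable_finsetSum _ fun i _ => integrable_finsetSum _ fun j _ => hg i j, ?_⟩
    rw [integral_finsetSum _ fun i _ => integrable_finsetSum _ fun j _ => hg i j]
    refine Finset.sum_congr rfl fun i _ => ?_
    rw [integral_finsetSum _ fun j _ => hg i j]
  obtain ⟨J1, s1⟩ := hsum _ I1
  obtain ⟨J2, s2⟩ := hsum _ I2
  obtain ⟨J3, s3⟩ := hsum _ I3
  unfold kidEst
  rw [kid_lin _ _ _ _ J1 J2 J3, s1, s2, s3]
  simp only [e1, e2, e3, kid_offdiag]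
  have hm' : (2 : ℝ) ≤ m := by exact_mod_cast hm
  have h0 : (m : ℝ) ≠ 0 := by linarith
  have h1 : (m : ℝ) - 1 ≠ 0 := by linarith
  simp
  field_simp


/-- Concentration of KID: if `0 ≤ k ≤ K`, then for two independent i.i.d. samples of size
`m`, `P[|KID − MMD²| > ε] ≤ 2 exp(−ε² m / (16 K²))`. -/
theorem stmt_18 {S : Type*} [MeasurableSpace S]
    (k : S → S → ℝ) (K : ℝ) (hK : 0 < K)
    (hk : ∀ x y, 0 ≤ k x y ∧ k x y ≤ K) (hsym : ∀ x y, k x y = k y x)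
    (hmeas : Measurable fun z : S × S => k z.1 z.2)
    (p q : Measure S) [IsProbabilityMeasure p] [IsProbabilityMeasure q]
    (m : ℕ) (hm : 2 ≤ m) (ε : ℝ) (hε : 0 < ε) :
    ((Measure.pi fun _ : Fin m => p).prod (Measure.pi fun _ : Fin m => q))
        {w : (Fin m → S) × (Fin m → S) |
          ε < |(((m : ℝ) * ((m : ℝ) - 1))⁻¹ *
                ∑ i, ∑ j, (if i ≠ j then k (w.1 i) (w.1 j) else 0)
              - 2 / ((m : ℝ) * (m : ℝ)) * ∑ i, ∑ j, k (w.1 i) (w.2 j)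
              + ((m : ℝ) * ((m : ℝ) - 1))⁻¹ *
                ∑ i, ∑ j, (if i ≠ j then k (w.2 i) (w.2 j) else 0))
            - ((∫ z : S × S, k z.1 z.2 ∂(p.prod p))
                - 2 * (∫ z : S × S, k z.1 z.2 ∂(p.prod q))
                + ∫ z : S × S, k z.1 z.2 ∂(q.prod q))|} ≤
      ENNReal.ofReal (2 * Real.exp (-(ε ^ 2 * (m : ℝ)) / (16 * K ^ 2))) := by
  obtain ⟨C, hC⟩ := kid_bdd k K hK hk m
  have hM := kid_meas k hmeas m
  have hm' : (2 : ℝ) ≤ m := by exact_mod_cast hm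
  have h0 : (m : ℝ) ≠ 0 := by linarith
  have hsec : ∀ x, Measurable fun y => kidEst k m (x, y) := fun x => hM.comp measurable_prodMk_left
  have hSG : KidSG ((Measure.pi fun _ : Fin m => p).prod (Measure.pi fun _ : Fin m => q))
      (kidEst k m) (m * ((4 * K / m) ^ 2 / 4) + m * ((4 * K / m) ^ 2 / 4)) := by
    refine kid_prod _ _ _ hM C hC _ _ ?_ ?_
    · intro x
      refine kid_mcdiarmid q _ m _ (hsec x) C (fun _ => hC _) ?_
      intro y a s
      rw [kid_symm k hsym m x, kid_symm k hsym m x]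
      exact kid_d1 k K hK hk m hm y x a s
    · refine kid_mcdiarmid p _ m _ (hM.stronglyMeasurable.integral_prod_right').measurable C
        (fun x => kid_abs_integral _ _ C fun y => hC _) ?_
      intro x a s
      rw [← integral_sub (kid_int_bdd _ _ (hsec _) C fun _ => hC _)
        (kid_int_bdd _ _ (hsec _) C fun _ => hC _)]
      exact kid_abs_integral _ _ _ fun y => kid_d1 k K hK hk m hm x y a s
  have := kid_tail _ _ hM C hC _ (by positivity) hSG ε hε
  rw [kid_mean k K hK hk hmeas p q m hm] at this
  refine this.trans (le_of_eq ?_)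
  congr 3
  field_simp
  ring
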